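/- If dependencies point only to earlier transactions, i.e., r i j → j < i for all i j : Fin n, then for all i k j : Fin n, M i k * M k j ≠ 0 ↔ (Relation.ReflTransGen r i k ∧ Relation.ReflTransGen r k j). Hence the nonzero entries of the element-wise product of row M i with column M · j are exactly the transactions k lying on some dependency path from T_i to T_j, which is the correctness of MTFS's second-scan extraction of critical intermediates. -/

import Mathlib

/-- A nonzero entry of a power of a matrix supported on `r` witnesses an `r`-path. -/
theorem Matrix.reflTransGen_of_pow_apply_ne_zero {ι R : Type*} [Fintype ι] [DecidableEq ι]
    [Semiring R] {r : ι → ι → Prop} {A : Matrix ι ι R} (hA : ∀ i j, A i j ≠ 0 → r i j)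
    (m : ℕ) {i j : ι} (h : (A ^ m) i j ≠ 0) : Relation.ReflTransGen r i j := by
  induction m generalizing j with
  | zero =>
    rw [pow_zero] at h
    by_cases hij : i = j
    · exact hij ▸ .refl
    · exact absurd (Matrix.one_apply_ne hij) h
  | succ m ih =>
    rw [pow_succ, Matrix.mul_apply] at h
    obtain ⟨k, -, hk⟩ := Finset.exists_ne_zero_of_sum_ne_zero h
    exact (ih (left_ne_zero_of_mul hk)).tail (hA _ _ (right_ne_zero_of_mul hk))

/-- If `r` strictly decreases indices, an `r`-path from `i` to `j` gives a nonzero entry of a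
power of the matrix whose exponent is at most `i - j`. -/
theorem Matrix.exists_pow_apply_ne_zero_of_reflTransGen {n : ℕ} {r : Fin n → Fin n → Prop}
    {A : Matrix (Fin n) (Fin n) ℕ} (hA : ∀ i j, r i j → A i j ≠ 0)
    (hlt : ∀ i j, r i j → j < i) {i j : Fin n} (h : Relation.ReflTransGen r i j) :
    ∃ m : ℕ, m + j ≤ (i : ℕ) ∧ (A ^ m) i j ≠ 0 := by
  induction h with
  | refl => exact ⟨0, by simp, by simp⟩
  | @tail b c _ hbc ih =>
    obtain ⟨m, hm, hne⟩ := ih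
    have hcb : (c : ℕ) < b := hlt b c hbc
    refine ⟨m + 1, by omega, ?_⟩
    rw [pow_succ, Matrix.mul_apply]
    exact fun h0 => mul_ne_zero hne (hA b c hbc) (Finset.sum_eq_zero_iff.mp h0 b (Finset.mem_univ b))

/-- If `r` strictly decreases indices, the sum of the first `n` powers of a matrix with support
`r` has support the reflexive transitive closure of `r`. -/
theorem Matrix.sum_pow_apply_ne_zero_iff_reflTransGen {n : ℕ} {r : Fin n → Fin n → Prop}
    {A : Matrix (Fin n) (Fin n) ℕ} (hA : ∀ i j, A i j ≠ 0 ↔ r i j)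
    (hlt : ∀ i j, r i j → j < i) (i j : Fin n) :
    (∑ k ∈ Finset.range n, A ^ k) i j ≠ 0 ↔ Relation.ReflTransGen r i j := by
  rw [Matrix.sum_apply]
  constructor
  · intro h
    obtain ⟨m, -, hm⟩ := Finset.exists_ne_zero_of_sum_ne_zero h
    exact reflTransGen_of_pow_apply_ne_zero (fun i j => (hA i j).mp) m hm
  · intro h h0
    obtain ⟨m, hm, hne⟩ :=
      exists_pow_apply_ne_zero_of_reflTransGen (fun i j => (hA i j).mpr) hlt h
    exact hne (Finset.sum_eq_zero_iff.mp h0 m (Finset.mem_range.mpr (by omega)))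

/-- Correctness of MTFS's second-scan extraction of critical
intermediates: if dependencies point only to earlier transactions, then the
element-wise product `M i k * M k j` is nonzero exactly when `k` lies on some
dependency path from `T_i` to `T_j`. -/
theorem mtfs_second_scan_critical_intermediates {n : ℕ} (r : Fin n → Fin n → Prop)
    [DecidableRel r]
    (A : Matrix (Fin n) (Fin n) ℕ)
    (hA : ∀ i j : Fin n, A i j = if r i j then 1 else 0)
    (M : Matrix (Fin n) (Fin n) ℕ)
    (hM : M = ∑ k ∈ Finset.range n, A ^ k)
    (hlt : ∀ i j : Fin n, r i j → j < i) :
    ∀ i k j : Fin n, M i k * M k j ≠ 0 ↔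
      (Relation.ReflTransGen r i k ∧ Relation.ReflTransGen r k j) := by
  have hsupp : ∀ i j, A i j ≠ 0 ↔ r i j := fun i j => by simp [hA]
  intro i k j
  rw [hM, mul_ne_zero_iff, Matrix.sum_pow_apply_ne_zero_iff_reflTransGen hsupp hlt,
    Matrix.sum_pow_apply_ne_zero_iff_reflTransGen hsupp hlt]
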